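/- Along any solution of the system, the maximal squared distance Ψ(t) = max_i dist(x_i(t), ℒ(y(t)))² satisfies D⁺√Ψ(t) ≤ q(t) for all t ≥ 0. -/

import Mathlib

open Metric Set Filter MeasureTheory

noncomputable section

/-- Data of the multi-agent system (5): the switching communication topology
(neighbor sets `Nb`, leader sets `Ld`), the weight functions `A` (= `a_{ij}`),
`B` (= `b_{ij}`), the dwell time `τD` and the weight bounds `aLo = a_*`,
`aHi = a^*`, `bLo = b_*`, together with Assumptions 1 and 2. -/
structure MASData (d n k : ℕ) where
  hn : 2 ≤ n
  hk : 1 ≤ k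
  Nb : ℝ → Fin n → Finset (Fin n)
  Ld : ℝ → Fin n → Finset (Fin k)
  A : Fin n → Fin n → (Fin n → EuclideanSpace ℝ (Fin d)) →
    (Fin k → EuclideanSpace ℝ (Fin d)) → ℝ → ℝ
  B : Fin n → Fin k → (Fin n → EuclideanSpace ℝ (Fin d)) →
    (Fin k → EuclideanSpace ℝ (Fin d)) → ℝ → ℝ
  τD : ℝ
  aLo : ℝ
  aHi : ℝ
  bLo : ℝ
  τD_pos : 0 < τD
  aLo_pos : 0 < aLo
  bLo_pos : 0 < bLo
  A_bdd : ∀ i j xv yv t, aLo ≤ A i j xv yv t ∧ A i j xv yv t ≤ aHi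
  B_bdd : ∀ i j xv yv t, bLo ≤ B i j xv yv t
  A_cont : ∀ i j, Continuous fun p :
    (Fin n → EuclideanSpace ℝ (Fin d)) × (Fin k → EuclideanSpace ℝ (Fin d)) × ℝ =>
    A i j p.1 p.2.1 p.2.2
  B_cont : ∀ i j, Continuous fun p :
    (Fin n → EuclideanSpace ℝ (Fin d)) × (Fin k → EuclideanSpace ℝ (Fin d)) × ℝ =>
    B i j p.1 p.2.1 p.2.2
  /-- The topology is piecewise constant with consecutive switching instants
  separated by at least the dwell time `τD` (Assumption 1). -/
  dwell : ∃ s : ℕ → ℝ, s 0 = 0 ∧ (∀ m : ℕ, s m + τD ≤ s (m + 1)) ∧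
    ∀ m : ℕ, ∀ t₁ ∈ Set.Ico (s m) (s (m + 1)), ∀ t₂ ∈ Set.Ico (s m) (s (m + 1)),
      Nb t₁ = Nb t₂ ∧ Ld t₁ = Ld t₂

namespace MASData

variable {d n k : ℕ}

/-- The arc relation of the communication graph at time `t`, on the node set
`Fin k ⊕ Fin n` (leaders ⊕ followers).  `arcAt t v v'` means there is an arc
leaving `v` and entering `v'`; there are no arcs from followers into leaders. -/
def arcAt (D : MASData d n k) (t : ℝ) (v v' : Fin k ⊕ Fin n) : Prop :=
  match v, v' with
  | Sum.inl j, Sum.inr i => j ∈ D.Ld t i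
  | Sum.inr j, Sum.inr i => j ∈ D.Nb t i
  | _, _ => False

/-- Arc relation of the union graph over the set of times `T`. -/
def arcOn (D : MASData d n k) (T : Set ℝ) (v v' : Fin k ⊕ Fin n) : Prop :=
  ∃ t ∈ T, D.arcAt t v v'

/-- The union graph over the set of times `T` is L-connected: every follower is
reachable from some leader by a directed path. -/
def LConnectedOn (D : MASData d n k) (T : Set ℝ) : Prop :=
  ∀ i : Fin n, ∃ j : Fin k, Relation.ReflTransGen (D.arcOn T) (Sum.inl j) (Sum.inr i)

/-- Uniformly jointly L-connected. -/
def UJLC (D : MASData d n k) : Prop :=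
  ∃ T > (0:ℝ), ∀ t ≥ (0:ℝ), D.LConnectedOn (Set.Ico t (t + T))

/-- Jointly L-connected. -/
def JLC (D : MASData d n k) : Prop :=
  ∀ t ≥ (0:ℝ), D.LConnectedOn (Set.Ici t)

end MASData

/-- A solution (trajectory) of system (5) together with its inputs: leader
controls `u`, disturbances `w`, follower states `x` and leader states `y`;
the dynamics hold in the sense of right derivatives for `t ≥ 0`, and the
(piecewise continuous) inputs are locally interval integrable along the
solution. -/
structure MASSol {d n k : ℕ} (D : MASData d n k) where
  x : ℝ → Fin n → EuclideanSpace ℝ (Fin d)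
  y : ℝ → Fin k → EuclideanSpace ℝ (Fin d)
  u : Fin k → (Fin k → EuclideanSpace ℝ (Fin d)) → ℝ → EuclideanSpace ℝ (Fin d)
  w : Fin n → ℝ → EuclideanSpace ℝ (Fin d)
  u_cont : ∀ j t, Continuous fun yv => u j yv t
  w_cont : ∀ i, Continuous (w i)
  x_cont : ∀ i, Continuous fun t => x t i
  y_cont : ∀ j, Continuous fun t => y t j
  dyn_y : ∀ (j : Fin k), ∀ t ≥ (0:ℝ),
    HasDerivWithinAt (fun s => y s j) (u j (y t) t) (Set.Ici t) t
  dyn_x : ∀ (i : Fin n), ∀ t ≥ (0:ℝ),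
    HasDerivWithinAt (fun s => x s i)
      ((∑ j ∈ D.Nb t i, D.A i j (x t) (y t) t • (x t j - x t i)) +
        (∑ j ∈ D.Ld t i, D.B i j (x t) (y t) t • (y t j - x t i)) + w i t)
      (Set.Ici t) t
  r_int : ∀ a b : ℝ, IntervalIntegrable (fun t => ⨆ j : Fin k, ‖u j (y t) t‖)
    MeasureTheory.volume a b
  q_int : ∀ a b : ℝ, IntervalIntegrable
    (fun t => (⨆ j : Fin k, ‖u j (y t) t‖) + ⨆ i : Fin n, ‖w i t‖)
    MeasureTheory.volume a b
  z_int : ∀ a b : ℝ, IntervalIntegrable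
    (fun t => Real.sqrt ((∑ j : Fin k, ‖u j (y t) t‖ ^ 2) + ∑ i : Fin n, ‖w i t‖ ^ 2))
    MeasureTheory.volume a b

namespace MASSol

variable {d n k : ℕ} {D : MASData d n k}

/-- The moving multi-leader set `ℒ(y(t))`: the convex hull of the leaders. -/
def Lset (sol : MASSol D) (t : ℝ) : Set (EuclideanSpace ℝ (Fin d)) :=
  convexHull ℝ (Set.range (sol.y t))

/-- `|x(t)|_{ℒ(y(t))}`: the maximal distance of the followers from `ℒ(y(t))`. -/
def distL (sol : MASSol D) (t : ℝ) : ℝ :=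
  ⨆ i : Fin n, Metric.infDist (sol.x t i) (sol.Lset t)

/-- `r(t) = max_j |u_j(y(t),t)|`. -/
def rmax (sol : MASSol D) (t : ℝ) : ℝ := ⨆ j : Fin k, ‖sol.u j (sol.y t) t‖

/-- `q(t) = max_j |u_j(y(t),t)| + max_i |w_i(t)|`. -/
def qmax (sol : MASSol D) (t : ℝ) : ℝ := sol.rmax t + ⨆ i : Fin n, ‖sol.w i t‖

/-- `|z(t)|`: the Euclidean norm of the combined input `z = (u, w)` at time `t`. -/
def znorm (sol : MASSol D) (t : ℝ) : ℝ :=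
  Real.sqrt ((∑ j : Fin k, ‖sol.u j (sol.y t) t‖ ^ 2) + ∑ i : Fin n, ‖sol.w i t‖ ^ 2)

/-- `‖z‖_∞ = sup_{t ≥ 0} |z(t)|`. -/
def zsup (sol : MASSol D) : ℝ := sSup (sol.znorm '' Set.Ici 0)

/-- The combined input `z` is (essentially) bounded, i.e. `z ∈ L_∞`. -/
def zBounded (sol : MASSol D) : Prop := BddAbove (sol.znorm '' Set.Ici 0)

end MASSol

/-- Class-𝒦 function on `[0,∞)`. -/
def IsClassK (γ : ℝ → ℝ) : Prop :=
  ContinuousOn γ (Set.Ici 0) ∧ StrictMonoOn γ (Set.Ici 0) ∧ γ 0 = 0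

/-- Class-𝒦𝓛 function. -/
def IsClassKL (β : ℝ → ℝ → ℝ) : Prop :=
  (∀ t ≥ (0:ℝ), IsClassK fun s => β s t) ∧
  (∀ s ≥ (0:ℝ), AntitoneOn (fun t => β s t) (Set.Ici 0) ∧
    Filter.Tendsto (fun t => β s t) Filter.atTop (nhds 0))

/-- System (5) is (generalized) set input-to-state stable with respect to
`ℒ(y(t))` with input `z`. -/
def MASData.SISS {d n k : ℕ} (D : MASData d n k) : Prop :=
  ∃ β γ, IsClassKL β ∧ IsClassK γ ∧
    ∀ sol : MASSol D, sol.zBounded →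
      ∀ t ≥ (0:ℝ), sol.distL t ≤ β (sol.distL 0) t + γ sol.zsup

/-- System (5) is (generalized) set integral-input-to-state stable with respect
to `ℒ(y(t))`. -/
def MASData.SiISS {d n k : ℕ} (D : MASData d n k) : Prop :=
  ∃ β γ, IsClassKL β ∧ IsClassK γ ∧
    ∀ sol : MASSol D, ∀ t ≥ (0:ℝ),
      sol.distL t ≤ β (sol.distL 0) t + ∫ s in (0:ℝ)..t, γ (sol.znorm s)

/-- The upper Dini derivative `D⁺h(t) = limsup_{s→0⁺} (h(t+s) − h(t))/s`. -/
def upperDini (h : ℝ → ℝ) (t : ℝ) : ℝ :=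
  Filter.limsup (fun s => (h (t + s) - h t) / s) (nhdsWithin 0 (Set.Ioi 0))

/-- A real upper limit is at most a nonnegative eventual upper bound, without any
boundedness assumption from below. -/
theorem limsup_le_of_eventually_le_of_nonneg {α : Type*} {l : Filter α} {f : α → ℝ} {c : ℝ}
    (hc : 0 ≤ c) (h : ∀ᶠ a in l, f a ≤ c) : limsup f l ≤ c := by
  rw [limsup_eq]
  by_cases hb : BddBelow {a | ∀ᶠ n in l, f n ≤ a}
  · exact csInf_le hb h
  · rwa [Real.sInf_of_not_bddBelow hb]

theorem Convex.add_sum_smul_sub_mem {ι E : Type*} [AddCommGroup E] [Module ℝ E] {K : Set E}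
    (hK : Convex ℝ K) {p : E} (hp : p ∈ K) {T : Finset ι} {c : ι → ℝ} {z : ι → E}
    (hz : ∀ i ∈ T, z i ∈ K) (hc : ∀ i ∈ T, 0 ≤ c i) (hsum : ∑ i ∈ T, c i ≤ 1) :
    p + ∑ i ∈ T, c i • (z i - p) ∈ K := by
  rcases (Finset.sum_nonneg hc).eq_or_lt with h0 | hpos
  · have hzero := (Finset.sum_eq_zero_iff_of_nonneg hc).1 h0.symm
    rw [Finset.sum_eq_zero fun i hi => by rw [hzero i hi, zero_smul], add_zero]
    exact hp
  · convert hK.add_smul_sub_mem hp (hK.centerMass_mem hc hpos hz) ⟨hpos.le, hsum⟩ using 2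
    rw [Finset.centerMass, smul_sub, smul_inv_smul₀ hpos.ne']
    simp only [smul_sub, Finset.sum_sub_distrib, Finset.sum_smul]

theorem HasDerivWithinAt.eventually_norm_sub_le {E : Type*} [NormedAddCommGroup E]
    [NormedSpace ℝ E] {f : ℝ → E} {v : E} {t : ℝ} (h : HasDerivWithinAt f v (Ici t) t)
    {ε : ℝ} (hε : 0 < ε) :
    ∀ᶠ s in nhdsWithin (0 : ℝ) (Ioi 0), ‖f (t + s) - (f t + s • v)‖ ≤ ε * s := by
  have hlim : Tendsto (fun s : ℝ => t + s) (nhdsWithin 0 (Ioi 0)) (nhdsWithin t (Ici t)) := by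
    refine tendsto_nhdsWithin_iff.2 ⟨?_, ?_⟩
    · have : Tendsto (fun s : ℝ => t + s) (nhds 0) (nhds (t + 0)) :=
        (continuous_const.add continuous_id).tendsto 0
      rw [add_zero] at this
      exact this.mono_left nhdsWithin_le_nhds
    · filter_upwards [self_mem_nhdsWithin] with s hs
      exact (lt_add_of_pos_right t hs).le
  filter_upwards [hlim.eventually ((hasDerivWithinAt_iff_isLittleO.1 h).bound hε),
    self_mem_nhdsWithin] with s hs hs0
  rwa [add_sub_cancel_left, Real.norm_of_nonneg (le_of_lt hs0), sub_sub] at hs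

theorem infDist_le_iff_mem_cthickening {E : Type*} [PseudoMetricSpace E] {K : Set E}
    (hK : K.Nonempty) {δ : ℝ} (hδ : 0 ≤ δ) {p : E} :
    infDist p K ≤ δ ↔ p ∈ cthickening δ K := by
  rw [mem_cthickening_iff, infDist, ENNReal.le_ofReal_iff_toReal_le (infEDist_ne_top hK) hδ]

theorem sqrt_iSup_infDist_sq_le_iff {ι E : Type*} [Finite ι] [Nonempty ι] [PseudoMetricSpace E]
    {p : ι → E} {K : Set E} {M : ℝ} (hM : 0 ≤ M) :
    Real.sqrt (⨆ i, infDist (p i) K ^ 2) ≤ M ↔ ∀ i, infDist (p i) K ≤ M := by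
  rw [Real.sqrt_le_left hM, ciSup_le_iff (Set.finite_range _).bddAbove]
  exact forall_congr' fun i => pow_le_pow_iff_left₀ infDist_nonneg hM two_ne_zero

namespace MASSol

variable {d n k : ℕ} {D : MASData d n k}

theorem Lset_nonempty (sol : MASSol D) (t : ℝ) : (sol.Lset t).Nonempty :=
  ⟨sol.y t ⟨0, D.hk⟩, subset_convexHull ℝ _ (mem_range_self _)⟩

theorem Lset_subset_cthickening (sol : MASSol D) {t t' δ : ℝ}
    (h : ∀ j, dist (sol.y t j) (sol.y t' j) ≤ δ) :
    sol.Lset t ⊆ cthickening δ (sol.Lset t') := by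
  refine convexHull_min ?_ ((convex_convexHull ℝ _).cthickening δ)
  rintro _ ⟨j, rfl⟩
  exact mem_cthickening_of_dist_le _ _ δ _ (subset_convexHull ℝ _ (mem_range_self j)) (h j)

theorem norm_u_le_rmax (sol : MASSol D) (t : ℝ) (j : Fin k) :
    ‖sol.u j (sol.y t) t‖ ≤ sol.rmax t :=
  le_ciSup (f := fun j => ‖sol.u j (sol.y t) t‖) (Set.finite_range _).bddAbove j

theorem rmax_nonneg (sol : MASSol D) (t : ℝ) : 0 ≤ sol.rmax t :=
  Real.iSup_nonneg fun _ => norm_nonneg _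

theorem qmax_nonneg (sol : MASSol D) (t : ℝ) : 0 ≤ sol.qmax t :=
  add_nonneg (sol.rmax_nonneg t) (Real.iSup_nonneg fun _ => norm_nonneg _)

theorem rmax_add_norm_w_le_qmax (sol : MASSol D) (t : ℝ) (i : Fin n) :
    sol.rmax t + ‖sol.w i t‖ ≤ sol.qmax t :=
  add_le_add_right (le_ciSup (f := fun i => ‖sol.w i t‖) (Set.finite_range _).bddAbove i) _

/-- The disturbance-free Euler step of a follower stays in any convex set containing all agents,
as soon as the step is small. -/
theorem eventually_euler_step_mem (sol : MASSol D) (t : ℝ) (i : Fin n) :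
    ∀ᶠ s in nhdsWithin (0 : ℝ) (Ioi 0), ∀ K : Set (EuclideanSpace ℝ (Fin d)), Convex ℝ K →
      (∀ j, sol.x t j ∈ K) → (∀ j, sol.y t j ∈ K) →
      sol.x t i + s • ((∑ j ∈ D.Nb t i, D.A i j (sol.x t) (sol.y t) t • (sol.x t j - sol.x t i)) +
        ∑ j ∈ D.Ld t i, D.B i j (sol.x t) (sol.y t) t • (sol.y t j - sol.x t i)) ∈ K := by
  let c : Fin n ⊕ Fin k → ℝ := Sum.elim (fun j => D.A i j (sol.x t) (sol.y t) t)
    (fun j => D.B i j (sol.x t) (sol.y t) t)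
  have hlim : Tendsto (fun s : ℝ => s * ∑ j ∈ (D.Nb t i).disjSum (D.Ld t i), c j)
      (nhdsWithin 0 (Ioi 0)) (nhds 0) := by
    have := (tendsto_id (x := nhds (0 : ℝ))).mul_const
      (∑ j ∈ (D.Nb t i).disjSum (D.Ld t i), c j)
    rw [zero_mul] at this
    exact this.mono_left nhdsWithin_le_nhds
  filter_upwards [self_mem_nhdsWithin, hlim.eventually (ge_mem_nhds one_pos)]
    with s hs hsum K hK hx hy
  have hc : ∀ j, 0 ≤ s * c j := by
    rintro (j | j)
    · exact mul_nonneg (le_of_lt hs) (D.aLo_pos.le.trans (D.A_bdd i j _ _ t).1)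
    · exact mul_nonneg (le_of_lt hs) (D.bLo_pos.le.trans (D.B_bdd i j _ _ t))
  have := hK.add_sum_smul_sub_mem (hx i) (T := (D.Nb t i).disjSum (D.Ld t i))
    (c := fun j => s * c j) (z := Sum.elim (sol.x t) (sol.y t))
    (by rintro (j | j) _ <;> simp [hx, hy]) (fun j _ => hc j) (by rwa [← Finset.mul_sum])
  simpa only [Finset.sum_disjSum, Sum.elim_inl, Sum.elim_inr, c, mul_smul, ← Finset.smul_sum,
    ← smul_add] using this

theorem eventually_dist_y_le (sol : MASSol D) {t : ℝ} (ht : 0 ≤ t) {ε : ℝ} (hε : 0 < ε) :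
    ∀ᶠ s in nhdsWithin (0 : ℝ) (Ioi 0), ∀ j,
      dist (sol.y t j) (sol.y (t + s) j) ≤ (sol.rmax t + ε) * s := by
  refine eventually_all.2 fun j => ?_
  filter_upwards [(sol.dyn_y j t ht).eventually_norm_sub_le hε, self_mem_nhdsWithin] with s hs hs0
  have hs0 : 0 < s := hs0
  have htri := norm_add_le (sol.y (t + s) j - (sol.y t j + s • sol.u j (sol.y t) t))
    (s • sol.u j (sol.y t) t)
  rw [norm_smul, Real.norm_of_nonneg hs0.le] at htri
  rw [dist_comm, dist_eq_norm, show sol.y (t + s) j - sol.y t j =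
    sol.y (t + s) j - (sol.y t j + s • sol.u j (sol.y t) t) + s • sol.u j (sol.y t) t by abel]
  nlinarith [mul_le_mul_of_nonneg_left (sol.norm_u_le_rmax t j) hs0.le]

/-- If all followers are within `H` of the leader hull at time `t`, then shortly afterwards they
are within `H + (q(t) + ε) s` of the moving hull. -/
theorem eventually_infDist_le (sol : MASSol D) {t H : ℝ} (ht : 0 ≤ t) (hH : 0 ≤ H)
    (hx : ∀ i, infDist (sol.x t i) (sol.Lset t) ≤ H) {ε : ℝ} (hε : 0 < ε) :
    ∀ᶠ s in nhdsWithin (0 : ℝ) (Ioi 0), ∀ i,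
      infDist (sol.x (t + s) i) (sol.Lset (t + s)) ≤ H + (sol.qmax t + ε) * s := by
  refine eventually_all.2 fun i => ?_
  filter_upwards [(sol.dyn_x i t ht).eventually_norm_sub_le (half_pos hε),
    sol.eventually_dist_y_le ht (half_pos hε), sol.eventually_euler_step_mem t i,
    self_mem_nhdsWithin] with s hs hy hstep hs0
  have hs0 : 0 < s := hs0
  set δ := (sol.rmax t + ε / 2) * s with hδ
  have hδ0 : 0 ≤ δ := mul_nonneg (add_nonneg (sol.rmax_nonneg t) (half_pos hε).le) hs0.le
  have hL := sol.Lset_subset_cthickening hy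
  have hmem := hstep (cthickening (H + δ) (sol.Lset (t + s)))
    ((convex_convexHull ℝ _).cthickening _)
    (fun j => cthickening_cthickening_subset hH hδ0 _ (cthickening_subset_of_subset H hL
      ((infDist_le_iff_mem_cthickening (sol.Lset_nonempty t) hH).1 (hx j))))
    (fun j => cthickening_mono (le_add_of_nonneg_left hH) _
      (hL (subset_convexHull ℝ _ (mem_range_self j))))
  rw [← infDist_le_iff_mem_cthickening (sol.Lset_nonempty _) (add_nonneg hH hδ0)] at hmem
  set v := (∑ j ∈ D.Nb t i, D.A i j (sol.x t) (sol.y t) t • (sol.x t j - sol.x t i)) +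
    ∑ j ∈ D.Ld t i, D.B i j (sol.x t) (sol.y t) t • (sol.y t j - sol.x t i)
  clear_value v
  have hdist : dist (sol.x (t + s) i) (sol.x t i + s • v) ≤ ε / 2 * s + s * ‖sol.w i t‖ := by
    have htri := norm_add_le (sol.x (t + s) i - (sol.x t i + s • (v + sol.w i t)))
      (s • sol.w i t)
    rw [norm_smul, Real.norm_of_nonneg hs0.le] at htri
    rw [dist_eq_norm, show sol.x (t + s) i - (sol.x t i + s • v) =
      sol.x (t + s) i - (sol.x t i + s • (v + sol.w i t)) + s • sol.w i t by
        rw [smul_add]; abel]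
    linarith
  have := infDist_le_infDist_add_dist (s := sol.Lset (t + s)) (x := sol.x (t + s) i)
    (y := sol.x t i + s • v)
  nlinarith [mul_le_mul_of_nonneg_left (sol.rmax_add_norm_w_le_qmax t i) hs0.le]

end MASSol

/-- **Lemma 10.**  Along any solution of system (5), the maximal squared
distance `Ψ(t) = max_i dist(x_i(t), ℒ(y(t)))²` satisfies `D⁺√Ψ(t) ≤ q(t)` for
all `t ≥ 0`. -/
theorem lemma10_dini_bound {d n k : ℕ} (D : MASData d n k) (sol : MASSol D)
    (t : ℝ) (ht : 0 ≤ t) :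
    upperDini
        (fun s => Real.sqrt (⨆ i : Fin n, Metric.infDist (sol.x s i) (sol.Lset s) ^ 2)) t
      ≤ sol.qmax t := by
  have : Nonempty (Fin n) := ⟨⟨0, zero_lt_two.trans_le D.hn⟩⟩
  refine le_of_forall_pos_le_add fun ε hε => limsup_le_of_eventually_le_of_nonneg
    (add_nonneg (sol.qmax_nonneg t) hε.le) ?_
  set H := Real.sqrt (⨆ i : Fin n, infDist (sol.x t i) (sol.Lset t) ^ 2)
  have hH : 0 ≤ H := Real.sqrt_nonneg _
  filter_upwards [sol.eventually_infDist_le ht hH ((sqrt_iSup_infDist_sq_le_iff hH).1 le_rfl) hε,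
    self_mem_nhdsWithin] with s hs hs0
  have hs0 : 0 < s := hs0
  rw [div_le_iff₀ hs0, sub_le_iff_le_add']
  exact (sqrt_iSup_infDist_sq_le_iff (add_nonneg hH
    (mul_nonneg (add_nonneg (sol.qmax_nonneg t) hε.le) hs0.le))).2 hs
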